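/- Assume Σ_{e=1}^l α(e) ≤ Σ_{e=1}^l β(e) for every l = 1,…,n. Then the set of x ∈ ℝ_{≥0}^n satisfying the linear ascending constraints Σ_{e=1}^l x(e) ≥ Σ_{e=1}^l α(e) for l = 1,…,n−1 and Σ_{e=1}^n x(e) = Σ_{e=1}^n α(e), together with the domination constraint x(e) ≤ β(e) for every e, equals the base B(f_β) of the polymatroid (E, f_β). -/

import Mathlib

attribute [local instance] Classical.propDecidable

/-- A rank function on the finite ground set `E`: nonnegative, zero on `∅`,
nondecreasing and submodular.  `(E, f)` is then a polymatroid. -/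
def IsRankFunction {E : Type*} [Fintype E] [DecidableEq E] (f : Finset E → ℝ) : Prop :=
  f ∅ = 0 ∧ (∀ A, 0 ≤ f A) ∧ (∀ A B : Finset E, A ⊆ B → f A ≤ f B) ∧
    ∀ A B : Finset E, f (A ∪ B) + f (A ∩ B) ≤ f A + f B

/-- The polymatroidal polyhedron `P(f)` of independent vectors. -/
def polyP {E : Type*} [Fintype E] (f : Finset E → ℝ) : Set (E → ℝ) :=
  {x | (∀ e, 0 ≤ x e) ∧ ∀ A : Finset E, ∑ e ∈ A, x e ≤ f A}

/-- The base `B(f)` of the polymatroid `(E, f)`. -/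
def polyBase {E : Type*} [Fintype E] (f : Finset E → ℝ) : Set (E → ℝ) :=
  {x ∈ polyP f | ∑ e, x e = f Finset.univ}

/-- `f_β(A) = min_{D ⊆ A} (f(D) + β(A ∖ D))`. -/
noncomputable def fbeta {E : Type*} [DecidableEq E] (f : Finset E → ℝ) (β : E → ℝ)
    (A : Finset E) : ℝ :=
  A.powerset.inf' ⟨∅, Finset.empty_mem_powerset A⟩ (fun D => f D + ∑ e ∈ A \ D, β e)

/-- `c j = ∑_{e=1}^j α(e)` where the ground set `{1,…,n}` is modelled by `Fin n`
(element `e : Fin n` stands for the index `e+1`, i.e. `{1,…,j}` is `{e | (e : ℕ) < j}`). -/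
noncomputable def cSum (n : ℕ) (α : Fin n → ℝ) (j : ℕ) : ℝ :=
  ∑ e ∈ Finset.univ.filter (fun e : Fin n => (e : ℕ) < j), α e

/-- `ζ(A) = max{c j : {1,…,j} ⊆ A, 0 ≤ j ≤ n}`. -/
noncomputable def zeta (n : ℕ) (α : Fin n → ℝ) (A : Finset (Fin n)) : ℝ :=
  ((Finset.range (n + 1)).filter (fun j => ∀ e : Fin n, (e : ℕ) < j → e ∈ A)).sup'
    ⟨0, by simp⟩ (cSum n α)

/-- `f(A) = c(n) - ζ(E \ A)`. -/
noncomputable def rankF (n : ℕ) (α : Fin n → ℝ) (A : Finset (Fin n)) : ℝ :=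
  cSum n α n - zeta n α (Finset.univ \ A)

theorem aux_zeta_le (n : ℕ) (α y : Fin n → ℝ) (hy : ∀ e, 0 ≤ y e)
    (h : ∀ l, l ≤ n → cSum n α l ≤ ∑ e ∈ Finset.univ.filter (fun e : Fin n => (e : ℕ) < l), y e)
    (A : Finset (Fin n)) : zeta n α A ≤ ∑ e ∈ A, y e := by
  unfold zeta
  refine Finset.sup'_le _ _ ?_
  intro j hj
  rw [Finset.mem_filter, Finset.mem_range] at hj
  refine (h j (by omega)).trans ?_
  refine Finset.sum_le_sum_of_subset_of_nonneg ?_ (fun e _ _ => hy e)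
  intro e he
  exact hj.2 e (Finset.mem_filter.1 he).2

theorem aux_le_zeta (n : ℕ) (α : Fin n → ℝ) (A : Finset (Fin n)) (j : ℕ) (hj : j ≤ n)
    (h : ∀ e : Fin n, (e : ℕ) < j → e ∈ A) : cSum n α j ≤ zeta n α A := by
  unfold zeta
  refine Finset.le_sup' (cSum n α) ?_
  rw [Finset.mem_filter, Finset.mem_range]
  exact ⟨by omega, h⟩

theorem aux_fbeta_le (n : ℕ) (f : Finset (Fin n) → ℝ) (β : Fin n → ℝ) (A D : Finset (Fin n))
    (h : D ⊆ A) : fbeta f β A ≤ f D + ∑ e ∈ A \ D, β e := by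
  unfold fbeta
  exact Finset.inf'_le (fun D => f D + ∑ e ∈ A \ D, β e) (Finset.mem_powerset.2 h)

theorem aux_le_fbeta (n : ℕ) (f : Finset (Fin n) → ℝ) (β : Fin n → ℝ) (A : Finset (Fin n))
    (a : ℝ) (h : ∀ D, D ⊆ A → a ≤ f D + ∑ e ∈ A \ D, β e) : a ≤ fbeta f β A := by
  unfold fbeta
  exact Finset.le_inf' _ _ (fun D hD => h D (Finset.mem_powerset.1 hD))

theorem aux_fbeta_univ (n : ℕ) (α β : Fin n → ℝ) (hβ : ∀ e, 0 ≤ β e)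
    (h : ∀ l, l ≤ n → cSum n α l ≤ ∑ e ∈ Finset.univ.filter (fun e : Fin n => (e : ℕ) < l), β e) :
    fbeta (rankF n α) β Finset.univ = cSum n α n := by
  apply le_antisymm
  · refine (aux_fbeta_le n _ β _ Finset.univ (Finset.Subset.refl _)).trans ?_
    have h0 := aux_le_zeta n α (Finset.univ \ Finset.univ) 0 (Nat.zero_le _)
      (fun e he => absurd he (Nat.not_lt_zero _))
    have h1 : cSum n α 0 = 0 := by simp [cSum]
    have h2 : ∑ e ∈ (Finset.univ : Finset (Fin n)) \ Finset.univ, β e = 0 := by simp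
    rw [h2]
    unfold rankF
    linarith
  · refine aux_le_fbeta n _ β _ _ ?_
    intro D _
    have := aux_zeta_le n α β hβ h (Finset.univ \ D)
    unfold rankF
    linarith

/-- Under `∑_{e=1}^l α e ≤ ∑_{e=1}^l β e` for all `l = 1,…,n`, the set of nonnegative
vectors satisfying the linear ascending constraints together with the domination
constraint `x ≤ β` equals the base `B(f_β)` of the polymatroid `(E, f_β)`. -/
theorem ascendingConstraints_dominated_eq_base (n : ℕ) (hn : 1 ≤ n)
    (α β : Fin n → ℝ) (hα : ∀ e, 0 ≤ α e) (hβ : ∀ e, 0 < β e)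
    (hfeas : ∀ l, 1 ≤ l → l ≤ n →
      cSum n α l ≤ ∑ e ∈ Finset.univ.filter (fun e : Fin n => (e : ℕ) < l), β e) :
    {x : Fin n → ℝ |
        (∀ e, 0 ≤ x e) ∧ (∀ e, x e ≤ β e) ∧
        (∀ l, 1 ≤ l → l ≤ n - 1 →
          cSum n α l ≤ ∑ e ∈ Finset.univ.filter (fun e : Fin n => (e : ℕ) < l), x e) ∧
        ∑ e, x e = cSum n α n} = polyBase (fbeta (rankF n α) β) := by
  have hz : ∀ y : Fin n → ℝ, cSum n y 0 = 0 := fun y => by simp [cSum]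
  have hN : ∀ y : Fin n → ℝ, cSum n y n = ∑ e, y e := fun y => by simp [cSum]
  have hfeas' : ∀ l, l ≤ n →
      cSum n α l ≤ ∑ e ∈ Finset.univ.filter (fun e : Fin n => (e : ℕ) < l), β e := by
    intro l hl
    rcases Nat.eq_zero_or_pos l with rfl | h
    · exact (hz α).le.trans (hz β).ge
    · exact hfeas l h hl
  have hU := aux_fbeta_univ n α β (fun e => (hβ e).le) hfeas'
  ext x
  constructor
  · rintro ⟨h0, hb, hl, hs⟩
    refine ⟨⟨h0, ?_⟩, hs.trans hU.symm⟩
    have hl' : ∀ l, l ≤ n →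
        cSum n α l ≤ ∑ e ∈ Finset.univ.filter (fun e : Fin n => (e : ℕ) < l), x e := by
      intro l hln
      rcases Nat.eq_zero_or_pos l with rfl | h
      · exact (hz α).le.trans (hz x).ge
      · rcases Nat.lt_or_ge l n with h' | h'
        · exact hl l h (by omega)
        · obtain rfl : l = n := le_antisymm hln h'
          exact hs.ge.trans (hN x).ge
    intro A
    refine aux_le_fbeta n _ β _ _ ?_
    intro D hD
    have h1 := aux_zeta_le n α x h0 hl' (Finset.univ \ D)
    have h2 := Finset.sum_sdiff (f := x) (Finset.subset_univ D)
    have h3 := Finset.sum_sdiff (f := x) hD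
    have h4 : ∑ e ∈ A \ D, x e ≤ ∑ e ∈ A \ D, β e := Finset.sum_le_sum (fun e _ => hb e)
    unfold rankF
    linarith
  · rintro ⟨⟨h0, hA⟩, hs⟩
    have hs' : ∑ e, x e = cSum n α n := hs.trans hU
    refine ⟨h0, ?_, ?_, hs'⟩
    · intro e
      have h1 := (hA {e}).trans (aux_fbeta_le n _ β {e} ∅ (Finset.empty_subset _))
      have h2 := aux_le_zeta n α (Finset.univ \ ∅) n le_rfl (fun e _ => by simp)
      simp only [Finset.sdiff_empty, Finset.sum_singleton, rankF] at h1 h2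
      linarith
    · intro l _ hl
      set L := Finset.univ.filter (fun e : Fin n => (e : ℕ) < l) with hL
      have h1 := (hA (Finset.univ \ L)).trans
        (aux_fbeta_le n _ β _ _ (Finset.Subset.refl _))
      have h2 := aux_le_zeta n α (Finset.univ \ (Finset.univ \ L)) l (by omega)
        (fun e he => by simp [hL, he])
      have h3 := Finset.sum_sdiff (f := x) (Finset.subset_univ L)
      rw [Finset.sdiff_self, Finset.sum_empty] at h1
      unfold rankF at h1
      linarith
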